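/- Assume relations (R1), (R2) and (R3) hold in R. Then for all 1 ≤ i < p < j < r ≤ n+1 one has [e_{i,j}, e_{p,r}]_c = B(p,j;j,r)·(q−1)·e_{i,r}·e_{p,j}. (Lemma 'lema2.2.201d', equation (2.2.7).) -/

import Mathlib

/-- `B(i,j;p,r) = ∏_{i≤ℓ≤j−1} ∏_{p≤h≤r−1} q_{ℓ,h}`. -/
def Bq {k : Type*} [Field k] (qm : ℕ → ℕ → k) (i j p r : ℕ) : k :=
  ∏ l ∈ Finset.Ico i j, ∏ h ∈ Finset.Ico p r, qm l h

/-- The iterated braided commutators `e_{i,j}`: `e_{i,i+1} = x_i` and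
`e_{i,j} = e_{i,j−1}·e_{j−1,j} − B(i,j−1;j−1,j)·e_{j−1,j}·e_{i,j−1}` for `j − i ≥ 2`. -/
def ee {k R : Type*} [Field k] [Ring R] [Algebra k R]
    (qm : ℕ → ℕ → k) (x : ℕ → R) : ℕ → ℕ → R
  | i, j =>
    if _ : j ≤ i + 1 then x i
    else
      ee qm x i (j - 1) * ee qm x (j - 1) j
        - Bq qm i (j - 1) (j - 1) j • (ee qm x (j - 1) j * ee qm x i (j - 1))
  termination_by i j => j - i
  decreasing_by all_goals omega

section RingIdentities

variable {k R : Type*} [Field k] [Ring R] [Algebra k R]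

theorem skewCommutator_mul {a b c : R} {β γ : k} (t : k) (hb : b * a = β • (a * b))
    (hc : c * a = γ • (a * c)) :
    (b * c - t • (c * b)) * a = (β * γ) • (a * (b * c - t • (c * b))) := by
  have h₁ : b * c * a = (β * γ) • (a * (b * c)) := by
    rw [mul_assoc, hc, mul_smul_comm, ← mul_assoc, hb, smul_mul_assoc, smul_smul, mul_assoc,
      mul_comm β]
  have h₂ : c * b * a = (β * γ) • (a * (c * b)) := by
    rw [mul_assoc, hb, mul_smul_comm, ← mul_assoc, hc, smul_mul_assoc, smul_smul, mul_assoc]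
  rw [sub_mul, smul_mul_assoc, h₁, h₂, mul_sub, mul_smul_comm]
  module

theorem mul_skewCommutator {a b c : R} {β γ : k} (t : k) (hb : a * b = β • (b * a))
    (hc : a * c = γ • (c * a)) :
    a * (b * c - t • (c * b)) = (β * γ) • ((b * c - t • (c * b)) * a) := by
  have h₁ : a * (b * c) = (β * γ) • (b * c * a) := by
    rw [← mul_assoc, hb, smul_mul_assoc, mul_assoc, hc, mul_smul_comm, smul_smul, ← mul_assoc]
  have h₂ : a * (c * b) = (β * γ) • (c * b * a) := by
    rw [← mul_assoc, hc, smul_mul_assoc, mul_assoc, hb, mul_smul_comm, smul_smul, ← mul_assoc,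
      mul_comm β]
  rw [mul_sub, mul_smul_comm, h₁, h₂, sub_mul, smul_mul_assoc]
  module

/-- The braided Jacobi identity when the outer two factors skew-commute. -/
theorem skewCommutator_assoc {a b c : R} {α β γ : k} (hac : a * c = γ • (c * a)) :
    (a * b - α • (b * a)) * c - (γ * β) • (c * (a * b - α • (b * a)))
      = a * (b * c - β • (c * b)) - (α * γ) • ((b * c - β • (c * b)) * a) := by
  have h₁ : b * a * c = γ • (b * c * a) := by
    rw [mul_assoc, hac, mul_smul_comm, mul_assoc]
  have h₂ : a * (c * b) = γ • (c * (a * b)) := by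
    rw [← mul_assoc, hac, smul_mul_assoc, mul_assoc]
  simp only [sub_mul, mul_sub, smul_mul_assoc, mul_smul_comm, h₁, h₂, mul_assoc]
  module

/-- Expansion of `u * v` for `v` the skew-commutator of `b` and `c`, where `u` skew-commutes
with `b`. -/
theorem mul_skewCommutator_expand {u b c w : R} {β δ ε : k} (hub : u * b = δ • (b * u))
    (huc : u * c - ε • (c * u) = w) :
    u * (b * c - β • (c * b)) - (δ * ε) • ((b * c - β • (c * b)) * u)
      = δ • (b * w) - β • (w * b) := by
  subst huc
  have h₁ : u * (b * c) = δ • (b * (u * c)) := by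
    rw [← mul_assoc, hub, smul_mul_assoc, mul_assoc]
  have h₂ : c * (u * b) = δ • (c * (b * u)) := by rw [hub, mul_smul_comm]
  simp only [sub_mul, mul_sub, smul_mul_assoc, mul_smul_comm, mul_assoc, h₁, h₂]
  module

/-- Expansion of `u * v` for `u` the skew-commutator of `a` and `b`, where `b` skew-commutes
with `v`. -/
theorem skewCommutator_mul_expand {a b v w : R} {α δ ε : k} (hbv : b * v = δ • (v * b))
    (hav : a * v - ε • (v * a) = w) :
    (a * b - α • (b * a)) * v - (δ * ε) • (v * (a * b - α • (b * a)))
      = δ • (w * b) - α • (b * w) := by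
  subst hav
  have h₁ : a * (b * v) = δ • (a * (v * b)) := by rw [hbv, mul_smul_comm]
  have h₂ : b * (v * a) = δ • (v * (b * a)) := by
    rw [← mul_assoc, hbv, smul_mul_assoc, mul_assoc]
  simp only [sub_mul, mul_sub, smul_mul_assoc, mul_smul_comm, mul_assoc, h₁, h₂]
  module

/-- The quantum Serre relations imply that `[[a, b], c]` skew-commutes with `b`. -/
theorem mul_eq_smul_of_serre {a b c u v w : R} {α β β' γ q : k} (hβ : β * β' = q⁻¹)
    (hq : q ≠ 0) (hq1 : 1 + q ≠ 0) (hu : a * b - α • (b * a) = u)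
    (hv : b * c - β • (c * b) = v) (hw : u * c - (γ * β) • (c * u) = w)
    (hac : a * c = γ • (c * a)) (hub : u * b = (α * q) • (b * u))
    (hbv : b * v = (q * β) • (v * b)) :
    w * b = (α * q * β') • (b * w) := by
  have hav : a * v - (α * γ) • (v * a) = w := by
    rw [← hw, ← hu, ← hv, skewCommutator_assoc hac]
  have h₁ := mul_skewCommutator_expand (β := β) hub hw
  have h₂ := skewCommutator_mul_expand (α := α) hbv hav
  rw [hv] at h₁
  rw [hu, show q * β * (α * γ) = α * q * (γ * β) by ring, h₁] at h₂
  have h₃ : ((1 + q) * β) • (w * b) = ((1 + q) * α) • (b * w) := by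
    linear_combination (norm := module) -h₂
  have hβ0 : β ≠ 0 := by
    rintro rfl
    exact inv_ne_zero hq (by rw [← hβ, zero_mul])
  have h₄ : α * q * β' = ((1 + q) * β)⁻¹ * ((1 + q) * α) := by
    have : β' = q⁻¹ * β⁻¹ := by rw [← hβ]; field_simp
    rw [this]
    field_simp
  rw [h₄, mul_smul, ← h₃, inv_smul_smul₀ (mul_ne_zero hq1 hβ0)]

end RingIdentities

section RootVectors

variable {k R : Type*} [Field k] [Ring R] [Algebra k R] {qm : ℕ → ℕ → k} {x : ℕ → R}

theorem Bq_mul_Bq_left {i j s : ℕ} (p r : ℕ) (hij : i ≤ j) (hjs : j ≤ s) :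
    Bq qm i j p r * Bq qm j s p r = Bq qm i s p r :=
  Finset.prod_Ico_consecutive _ hij hjs

theorem Bq_mul_Bq_right (i j : ℕ) {p r s : ℕ} (hpr : p ≤ r) (hrs : r ≤ s) :
    Bq qm i j p r * Bq qm i j r s = Bq qm i j p s := by
  simp only [Bq, ← Finset.prod_mul_distrib, Finset.prod_Ico_consecutive _ hpr hrs]

theorem Bq_succ_right (i j s : ℕ) : Bq qm i j s (s + 1) = ∏ l ∈ Finset.Ico i j, qm l s := by
  simp [Bq]

theorem Bq_mul_Bq_swap (i j p r : ℕ) :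
    Bq qm i j p r * Bq qm p r i j
      = ∏ l ∈ Finset.Ico i j, ∏ h ∈ Finset.Ico p r, qm l h * qm h l := by
  rw [Bq, Bq, Finset.prod_comm (s := Finset.Ico p r)]
  simp only [Finset.prod_mul_distrib]

theorem ee_succ_self (i : ℕ) : ee qm x i (i + 1) = x i := by
  rw [ee, dif_pos le_rfl]

theorem ee_succ {i j : ℕ} (hij : i < j) :
    ee qm x i (j + 1)
      = ee qm x i j * x j - Bq qm i j j (j + 1) • (x j * ee qm x i j) := by
  rw [ee, dif_neg (by omega), Nat.add_sub_cancel, ee_succ_self]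

theorem ee_mul_eq_smul {a : R} {c : ℕ → k} {i j : ℕ} (hij : i < j)
    (h : ∀ l, i ≤ l → l < j → x l * a = c l • (a * x l)) :
    ee qm x i j * a = (∏ l ∈ Finset.Ico i j, c l) • (a * ee qm x i j) := by
  induction j, hij using Nat.le_induction with
  | base => simpa [ee_succ_self] using h i le_rfl (Nat.lt_succ_self i)
  | succ j hij ih =>
    rw [ee_succ hij, Finset.prod_Ico_succ_top (Nat.le_of_succ_le hij)]
    exact skewCommutator_mul _ (ih fun l h₁ h₂ => h l h₁ (by omega))
      (h j (Nat.le_of_succ_le hij) (Nat.lt_succ_self j))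

theorem mul_ee_eq_smul {a : R} {c : ℕ → k} {i j : ℕ} (hij : i < j)
    (h : ∀ l, i ≤ l → l < j → a * x l = c l • (x l * a)) :
    a * ee qm x i j = (∏ l ∈ Finset.Ico i j, c l) • (ee qm x i j * a) := by
  induction j, hij using Nat.le_induction with
  | base => simpa [ee_succ_self] using h i le_rfl (Nat.lt_succ_self i)
  | succ j hij ih =>
    rw [ee_succ hij, Finset.prod_Ico_succ_top (Nat.le_of_succ_le hij)]
    exact mul_skewCommutator _ (ih fun l h₁ h₂ => h l h₁ (by omega))
      (h j (Nat.le_of_succ_le hij) (Nat.lt_succ_self j))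

/-- The root vector `e_{i,r}` is the braided commutator of `e_{i,j}` and `e_{j,r}` for every
intermediate `j`. -/
theorem ee_eq_skewCommutator {n : ℕ}
    (hcomm : ∀ l s, 1 ≤ l → l ≤ n → 1 ≤ s → s ≤ n → (l + 2 ≤ s ∨ s + 2 ≤ l) →
      x l * x s = qm l s • (x s * x l))
    {i j r : ℕ} (hi : 1 ≤ i) (hij : i < j) (hjr : j < r) (hr : r ≤ n + 1) :
    ee qm x i r
      = ee qm x i j * ee qm x j r - Bq qm i j j r • (ee qm x j r * ee qm x i j) := by
  induction r, hjr using Nat.le_induction with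
  | base => rw [ee_succ hij, ee_succ_self]
  | succ r hjr ih =>
    have hfar : ee qm x i j * x r = Bq qm i j r (r + 1) • (x r * ee qm x i j) := by
      rw [Bq_succ_right]
      exact ee_mul_eq_smul hij fun l h₁ h₂ =>
        hcomm l r (by omega) (by omega) (by omega) (by omega) (by omega)
    rw [ee_succ (show i < r by omega), ee_succ (show j < r by omega), ih (by omega),
      ← Bq_mul_Bq_left (j := j) r (r + 1) (by omega) (by omega), skewCommutator_assoc hfar,
      Bq_mul_Bq_right i j (by omega) (by omega)]

/-- The root vector `e_{i,r}` skew-commutes with every `x s` for `i < s < r`. -/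
theorem ee_mul_x_eq_smul {n : ℕ} {q : k} (hq : q ≠ 0) (hq1 : 1 + q ≠ 0)
    (hdiag : ∀ i, 1 ≤ i → i ≤ n → qm i i = q)
    (hadj : ∀ i, 1 ≤ i → i + 1 ≤ n → qm i (i + 1) * qm (i + 1) i = q⁻¹)
    (hcomm : ∀ l s, 1 ≤ l → l ≤ n → 1 ≤ s → s ≤ n → (l + 2 ≤ s ∨ s + 2 ≤ l) →
      x l * x s = qm l s • (x s * x l))
    (R2 : ∀ i, 1 ≤ i → i < n →
      ee qm x i (i+1) * ee qm x i (i+2)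
        = Bq qm i (i+1) i (i+2) • (ee qm x i (i+2) * ee qm x i (i+1)))
    (R3 : ∀ i, 1 ≤ i → i < n →
      ee qm x i (i+2) * ee qm x (i+1) (i+2)
        = Bq qm i (i+2) (i+1) (i+2) • (ee qm x (i+1) (i+2) * ee qm x i (i+2)))
    {i s r : ℕ} (hi : 1 ≤ i) (his : i < s) (hsr : s < r) (hr : r ≤ n + 1) :
    ee qm x i r * x s = Bq qm i r s (s + 1) • (x s * ee qm x i r) := by
  have extend_left : ∀ j t, i ≤ j → j < s → j < t → t ≤ n + 1 →
      ee qm x j t * x s = Bq qm j t s (s + 1) • (x s * ee qm x j t) →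
      ee qm x i t * x s = Bq qm i t s (s + 1) • (x s * ee qm x i t) := by
    intro j t hij hjs hjt ht h
    obtain rfl | hij := hij.eq_or_lt
    · exact h
    rw [ee_eq_skewCommutator hcomm hi hij hjt ht,
      ← Bq_mul_Bq_left (j := j) s (s + 1) hij.le hjt.le]
    refine skewCommutator_mul _ ?_ h
    rw [Bq_succ_right]
    exact ee_mul_eq_smul hij fun l h₁ h₂ =>
      hcomm l s (by omega) (by omega) (by omega) (by omega) (by omega)
  obtain ⟨m, rfl⟩ : ∃ m, s = m + 1 := ⟨s - 1, by omega⟩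
  obtain rfl | hsr := (Nat.succ_le_of_lt hsr).eq_or_lt
  · refine extend_left m _ (by omega) (by omega) (by omega) hr ?_
    simpa only [ee_succ_self] using R3 m (by omega) (by omega)
  · have triple : ee qm x m (m + 3) * x (m + 1)
        = Bq qm m (m + 3) (m + 1) (m + 1 + 1) • (x (m + 1) * ee qm x m (m + 3)) := by
      have hB : Bq qm m (m + 3) (m + 1) (m + 1 + 1)
          = qm m (m + 1) * q * qm (m + 2) (m + 1) := by
        rw [Bq_succ_right, Finset.prod_Ico_succ_top (by omega), Finset.prod_Ico_succ_top (by omega),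
          Nat.Ico_succ_singleton, Finset.prod_singleton, hdiag _ (by omega) (by omega)]
      rw [hB]
      have h₂ := R2 (m + 1) (by omega) (by omega)
      have h₃ := R3 m (by omega) (by omega)
      have hB₂ : Bq qm (m + 1) (m + 1 + 1) (m + 1) (m + 1 + 2) = q * qm (m + 1) (m + 2) := by
        simp [Bq, Finset.prod_Ico_succ_top, hdiag (m + 1) (by omega) (by omega)]
      have hB₃ : Bq qm m (m + 2) (m + 1) (m + 2) = qm m (m + 1) * q := by
        simp [Bq, Finset.prod_Ico_succ_top, hdiag (m + 1) (by omega) (by omega)]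
      rw [hB₂, ee_succ_self] at h₂
      rw [hB₃, ee_succ_self] at h₃
      refine mul_eq_smul_of_serre (a := x m) (c := x (m + 2)) (γ := qm m (m + 2))
        (hadj (m + 1) (by omega) (by omega)) hq hq1 ?_ ?_ ?_
        (hcomm m (m + 2) (by omega) (by omega) (by omega) (by omega) (by omega)) h₃ h₂
      · rw [ee_succ (show m < m + 1 by omega), ee_succ_self]
        simp [Bq]
      · rw [ee_succ (show m + 1 < m + 2 by omega), ee_succ_self]
        simp [Bq]
      · rw [ee_succ (show m < m + 2 by omega)]
        simp [Bq, Finset.prod_Ico_succ_top]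
    have h := extend_left m (m + 3) (by omega) (by omega) (by omega) (by omega) triple
    obtain rfl | hsr := (Nat.succ_le_of_lt hsr).eq_or_lt
    · exact h
    rw [ee_eq_skewCommutator hcomm hi (show i < m + 3 by omega) hsr hr,
      ← Bq_mul_Bq_left (j := m + 3) (m + 1) (m + 1 + 1) (by omega) hsr.le]
    refine skewCommutator_mul _ h ?_
    rw [Bq_succ_right]
    exact ee_mul_eq_smul hsr fun l h₁ h₂ =>
      hcomm l (m + 1) (by omega) (by omega) (by omega) (by omega) (by omega)

theorem Bq_mul_Bq_swap_adjacent {n : ℕ} {q : k}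
    (hadj : ∀ i, 1 ≤ i → i + 1 ≤ n → qm i (i + 1) * qm (i + 1) i = q⁻¹)
    (hfar : ∀ i j, 1 ≤ i → i + 2 ≤ j → j ≤ n → qm i j * qm j i = 1)
    {p j r : ℕ} (hp : 1 ≤ p) (hpj : p < j) (hjr : j < r) (hr : r ≤ n + 1) :
    Bq qm p j j r * Bq qm j r p j = q⁻¹ := by
  obtain ⟨m, rfl⟩ : ∃ m, j = m + 1 := ⟨j - 1, by omega⟩
  rw [Bq_mul_Bq_swap, Finset.prod_eq_single m, Finset.prod_eq_single (m + 1)]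
  · exact hadj m (by omega) (by omega)
  · intro h hh hne
    rw [Finset.mem_Ico] at hh
    exact hfar m h (by omega) (by omega) (by omega)
  · intro h
    exact absurd (Finset.mem_Ico.2 ⟨le_rfl, hjr⟩) h
  · intro l hl hne
    rw [Finset.mem_Ico] at hl
    refine Finset.prod_eq_one fun h hh => ?_
    rw [Finset.mem_Ico] at hh
    exact hfar l h (by omega) (by omega) (by omega)
  · intro h
    exact absurd (Finset.mem_Ico.2 ⟨by omega, by omega⟩) h

end RootVectors

/-- Lemma `lema2.2.201d`, equation (2.2.7): `[e_{i,j}, e_{p,r}]_c = B(p,j;j,r)·(q−1)·e_{i,r}·e_{p,j}` for `i < p < j < r`. -/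
theorem lema2_2_201d {k R : Type*} [Field k] [Ring R] [Algebra k R]
    (n N : ℕ) (hn : 1 ≤ n) (hN : 2 < N) (q : k) (hq : IsPrimitiveRoot q N)
    (qm : ℕ → ℕ → k)
    (hqne : ∀ i j, 1 ≤ i → i ≤ n → 1 ≤ j → j ≤ n → qm i j ≠ 0)
    (hdiag : ∀ i, 1 ≤ i → i ≤ n → qm i i = q)
    (hadj : ∀ i j, 1 ≤ i → i ≤ n → 1 ≤ j → j ≤ n → (i = j + 1 ∨ j = i + 1) →
      qm i j * qm j i = q⁻¹)
    (hfar : ∀ i j, 1 ≤ i → i ≤ n → 1 ≤ j → j ≤ n → (i + 2 ≤ j ∨ j + 2 ≤ i) →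
      qm i j * qm j i = 1)
    (x : ℕ → R)
    (R1 : ∀ i p, 1 ≤ i → i < p → p ≤ n → i + 2 ≤ p →
      x i * x p = qm i p • (x p * x i))
    (R2 : ∀ i, 1 ≤ i → i < n →
      ee qm x i (i+1) * ee qm x i (i+2)
        = Bq qm i (i+1) i (i+2) • (ee qm x i (i+2) * ee qm x i (i+1)))
    (R3 : ∀ i, 1 ≤ i → i < n →
      ee qm x i (i+2) * ee qm x (i+1) (i+2)
        = Bq qm i (i+2) (i+1) (i+2) • (ee qm x (i+1) (i+2) * ee qm x i (i+2)))
    : ∀ i p j r, 1 ≤ i → i < p → p < j → j < r → r ≤ n + 1 →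
      ee qm x i j * ee qm x p r - Bq qm i j p r • (ee qm x p r * ee qm x i j)
        = (Bq qm p j j r * (q - 1)) • (ee qm x i r * ee qm x p j) := by
  have hq0 : q ≠ 0 := hq.ne_zero (by omega)
  have hq1 : 1 + q ≠ 0 := by
    intro h
    have hsq : q ^ 2 = 1 := by linear_combination (q - 1) * h
    have := Nat.le_of_dvd two_pos (hq.dvd_of_pow_eq_one 2 hsq)
    omega
  have hcomm : ∀ l s, 1 ≤ l → l ≤ n → 1 ≤ s → s ≤ n → (l + 2 ≤ s ∨ s + 2 ≤ l) →
      x l * x s = qm l s • (x s * x l) := by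
    rintro l s hl hln hs hsn (h | h)
    · exact R1 l s hl (by omega) hsn h
    · rw [R1 s l hs (by omega) hln h, smul_smul,
        hfar l s hl hln hs hsn (Or.inr h), one_smul]
  have hadj' : ∀ i, 1 ≤ i → i + 1 ≤ n → qm i (i + 1) * qm (i + 1) i = q⁻¹ := fun i h₁ h₂ =>
    hadj i (i + 1) h₁ (by omega) (by omega) h₂ (Or.inr rfl)
  intro i p j r hi hip hpj hjr hr
  have hskew : ∀ t, j ≤ t → t ≤ n + 1 →
      ee qm x i t * ee qm x p j = Bq qm i t p j • (ee qm x p j * ee qm x i t) := by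
    intro t hjt ht
    rw [Bq, Finset.prod_comm]
    refine mul_ee_eq_smul hpj fun l h₁ h₂ => ?_
    rw [← Bq_succ_right]
    exact ee_mul_x_eq_smul hq0 hq1 hdiag hadj' hcomm R2 R3 hi (by omega) (by omega) ht
  have hB := Bq_mul_Bq_swap_adjacent hadj'
    (fun a b h₁ h₂ h₃ => hfar a b h₁ (by omega) (by omega) h₃ (Or.inl h₂))
    (show 1 ≤ p by omega) hpj hjr hr
  have key := mul_skewCommutator_expand (β := Bq qm p j j r) (hskew j le_rfl (by omega))
    (ee_eq_skewCommutator hcomm hi (show i < j by omega) hjr hr).symm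
  rw [← ee_eq_skewCommutator hcomm (by omega) hpj hjr hr,
    Bq_mul_Bq_right i j hpj.le hjr.le] at key
  rw [key, hskew r hjr.le hr, smul_smul, smul_smul, ← sub_smul,
    ← Bq_mul_Bq_left (qm := qm) p j (show i ≤ j by omega) hjr.le]
  congr 1
  have hB' : q * (Bq qm p j j r * Bq qm j r p j) = 1 := by rw [hB, mul_inv_cancel₀ hq0]
  linear_combination -Bq qm i j p j * hB'
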